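/- arXiv:1909.02904 — 3 statements merged into one kernel-verified Lean document; each statement's English description precedes it below -/
import Mathlib

section
/- Let ρ be a density matrix on ℂ^n with spectral decomposition ρ = Σ_i p_i v_i v_i†, and let A, B be Hermitian n×n complex matrices. Define U^SLD_ρ(X) := √(V_ρ(X)² − (V_ρ(X) − I_SLD(ρ,X))²) for Hermitian X. Then U^SLD_ρ(A) · U^SLD_ρ(B) ≥ (1/4)|Tr[ρ(AB − BA)]|². -/
open Matrix
open scoped ComplexOrder

/-- The variance `V_ρ(X) = Tr[ρX²] − (Tr[ρX])²`. -/
noncomputable def matVariance {n : ℕ} (ρ X : Matrix (Fin n) (Fin n) ℂ) : ℝ :=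
  ((ρ * (X * X)).trace).re - (((ρ * X).trace).re) ^ 2

/-- The SLD skew information `I_SLD(ρ,A) = (1/2) Σ_{i,j} (p_i−p_j)²/(p_i+p_j) |v_i† A v_j|²`,
expressed via a spectral decomposition of `ρ` with eigenvalues `p` and orthonormal
eigenvectors `v`.  (Terms with `p i + p j = 0` vanish, since division by zero is zero.) -/
noncomputable def sldSkew {n : ℕ} (p : Fin n → ℝ) (v : Fin n → Fin n → ℂ)
    (A : Matrix (Fin n) (Fin n) ℂ) : ℝ :=
  (1 / 2) * ∑ i, ∑ j, (p i - p j) ^ 2 / (p i + p j) * ‖star (v i) ⬝ᵥ A.mulVec (v j)‖ ^ 2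

/-- `U^SLD_ρ(X) := √(V_ρ(X)² − (V_ρ(X) − I_SLD(ρ,X))²)`. -/
noncomputable def Usld {n : ℕ} (ρ : Matrix (Fin n) (Fin n) ℂ)
    (p : Fin n → ℝ) (v : Fin n → Fin n → ℂ) (X : Matrix (Fin n) (Fin n) ℂ) : ℝ :=
  Real.sqrt ((matVariance ρ X) ^ 2 - (matVariance ρ X - sldSkew p v X) ^ 2)

/-- The sum `∑_{i ≠ j} ((p_i + p_j) / 2) |a_ij|²`, a lower bound for the variance. -/
noncomputable def offDiagWeight {n : ℕ} (p : Fin n → ℝ) (a : Matrix (Fin n) (Fin n) ℂ) : ℝ :=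
  ∑ i, ∑ j, (if i = j then 0 else (p i + p j) / 2) * ‖a i j‖ ^ 2

/-- The skew information of `a` in the diagonal state with eigenvalues `p`. -/
noncomputable def diagSkew {n : ℕ} (p : Fin n → ℝ) (a : Matrix (Fin n) (Fin n) ℂ) : ℝ :=
  (1 / 2) * ∑ i, ∑ j, (p i - p j) ^ 2 / (p i + p j) * ‖a i j‖ ^ 2

section Diagonal

variable {n : ℕ} {p : Fin n → ℝ} {a b : Matrix (Fin n) (Fin n) ℂ}

theorem diagSkew_nonneg (hp : ∀ i, 0 ≤ p i) : 0 ≤ diagSkew p a := by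
  refine mul_nonneg (by norm_num) (Finset.sum_nonneg fun i _ => Finset.sum_nonneg fun j _ => ?_)
  have := hp i
  have := hp j
  positivity

theorem diagSkew_le_offDiagWeight (hp : ∀ i, 0 ≤ p i) : diagSkew p a ≤ offDiagWeight p a := by
  simp only [diagSkew, offDiagWeight, Finset.mul_sum]
  refine Finset.sum_le_sum fun i _ => Finset.sum_le_sum fun j _ => ?_
  rw [← mul_assoc]
  refine mul_le_mul_of_nonneg_right ?_ (by positivity)
  have hi := hp i
  have hj := hp j
  split_ifs with h
  · simp [h]
  · have : (p i - p j) ^ 2 / (p i + p j) ≤ p i + p j :=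
      div_le_of_le_mul₀ (by positivity) (by positivity) (by nlinarith [mul_nonneg hi hj])
    linarith

theorem trace_diagonal_mul_mul (p : Fin n → ℝ) (a b : Matrix (Fin n) (Fin n) ℂ) :
    (diagonal (fun i => (p i : ℂ)) * (a * b)).trace = ∑ i, ∑ j, (p i : ℂ) * (a i j * b j i) := by
  simp only [Matrix.trace, diag_apply, diagonal_mul]
  simp only [Matrix.mul_apply, Finset.mul_sum]

theorem trace_diagonal_mul_commutator (p : Fin n → ℝ) (a b : Matrix (Fin n) (Fin n) ℂ) :
    (diagonal (fun i => (p i : ℂ)) * (a * b - b * a)).trace =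
      ∑ i, ∑ j, ((p i - p j : ℝ) : ℂ) * (a i j * b j i) := by
  have h : ∑ i, ∑ j, (p i : ℂ) * (b i j * a j i) = ∑ i, ∑ j, (p j : ℂ) * (a i j * b j i) := by
    rw [Finset.sum_comm]
    exact Finset.sum_congr rfl fun i _ => Finset.sum_congr rfl fun j _ => by ring
  rw [mul_sub, trace_sub, trace_diagonal_mul_mul, trace_diagonal_mul_mul, h]
  simp only [← Finset.sum_sub_distrib]
  exact Finset.sum_congr rfl fun i _ => Finset.sum_congr rfl fun j _ => by push_cast; ring

/-- The weighted Cauchy–Schwarz inequality behind the uncertainty relation. -/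
theorem norm_trace_commutator_sq_le (hp : ∀ i, 0 ≤ p i) (hb : b.IsHermitian) :
    (1 / 4) * ‖(diagonal (fun i => (p i : ℂ)) * (a * b - b * a)).trace‖ ^ 2 ≤
      diagSkew p a * offDiagWeight p b := by
  have hle : ‖(diagonal (fun i => (p i : ℂ)) * (a * b - b * a)).trace‖ ≤
      ∑ x : Fin n × Fin n, |p x.1 - p x.2| * (‖a x.1 x.2‖ * ‖b x.1 x.2‖) := by
    rw [trace_diagonal_mul_commutator, Fintype.sum_prod_type]
    refine norm_sum_le_of_le _ fun i _ => norm_sum_le_of_le _ fun j _ => ?_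
    rw [norm_mul, norm_mul, Complex.norm_real, Real.norm_eq_abs, ← hb.apply j i, norm_star]
  have hcs : (∑ x : Fin n × Fin n, |p x.1 - p x.2| / 2 * (‖a x.1 x.2‖ * ‖b x.1 x.2‖)) ^ 2 ≤
      (∑ x : Fin n × Fin n, 1 / 2 * ((p x.1 - p x.2) ^ 2 / (p x.1 + p x.2) * ‖a x.1 x.2‖ ^ 2)) *
      ∑ x : Fin n × Fin n, (if x.1 = x.2 then 0 else (p x.1 + p x.2) / 2) * ‖b x.1 x.2‖ ^ 2 := by
    refine Finset.sum_sq_le_sum_mul_sum_of_sq_le_mul _ ?_ ?_ ?_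
    · rintro ⟨i, j⟩ -
      have := hp i
      have := hp j
      positivity
    · rintro ⟨i, j⟩ -
      have := hp i
      have := hp j
      dsimp only
      split_ifs <;> positivity
    · rintro ⟨i, j⟩ -
      dsimp only
      refine le_of_eq ?_
      split_ifs with h
      · simp [h]
      · rw [mul_pow, div_pow, sq_abs]
        rcases eq_or_ne (p i + p j) 0 with h0 | h0
        · have hi : p i = 0 := by linarith [hp i, hp j]
          have hj : p j = 0 := by linarith [hp i, hp j]
          simp [hi, hj]
        · field_simp
  have hskew : diagSkew p a = ∑ x : Fin n × Fin n,
      1 / 2 * ((p x.1 - p x.2) ^ 2 / (p x.1 + p x.2) * ‖a x.1 x.2‖ ^ 2) := by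
    rw [diagSkew, ← Finset.mul_sum, Fintype.sum_prod_type]
  have hweight : offDiagWeight p b = ∑ x : Fin n × Fin n,
      (if x.1 = x.2 then 0 else (p x.1 + p x.2) / 2) * ‖b x.1 x.2‖ ^ 2 := by
    rw [offDiagWeight, Fintype.sum_prod_type]
  rw [hskew, hweight]
  refine le_trans ?_ hcs
  simp only [div_mul_eq_mul_div, ← Finset.sum_div]
  rw [div_pow]
  have := pow_le_pow_left₀ (norm_nonneg _) hle 2
  linarith

theorem offDiagWeight_le_variance (hp : ∀ i, 0 ≤ p i) (hp1 : ∑ i, p i = 1)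
    (ha : a.IsHermitian) :
    offDiagWeight p a ≤ matVariance (diagonal fun i => (p i : ℂ)) a := by
  have h1 : ((diagonal (fun i => (p i : ℂ)) * (a * a)).trace).re =
      ∑ i, ∑ j, p i * ‖a i j‖ ^ 2 := by
    rw [trace_diagonal_mul_mul, Complex.re_sum]
    refine Finset.sum_congr rfl fun i _ => ?_
    rw [Complex.re_sum]
    refine Finset.sum_congr rfl fun j _ => ?_
    rw [← ha.apply j i, ← starRingEnd_apply, Complex.mul_conj', ← Complex.ofReal_pow,
      ← Complex.ofReal_mul, Complex.ofReal_re]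
  have h2 : ∑ i, ∑ j, p i * ‖a i j‖ ^ 2 = ∑ i, ∑ j, (p i + p j) / 2 * ‖a i j‖ ^ 2 := by
    have hs : ∑ i, ∑ j, p i * ‖a i j‖ ^ 2 = ∑ i, ∑ j, p j * ‖a i j‖ ^ 2 := by
      rw [Finset.sum_comm]
      refine Finset.sum_congr rfl fun i _ => Finset.sum_congr rfl fun j _ => ?_
      rw [← ha.apply j i, norm_star]
    have hadd : ∑ i, ∑ j, (p i + p j) / 2 * ‖a i j‖ ^ 2 =
        (∑ i, ∑ j, p i * ‖a i j‖ ^ 2 + ∑ i, ∑ j, p j * ‖a i j‖ ^ 2) / 2 := by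
      simp only [← Finset.sum_add_distrib, Finset.sum_div]
      exact Finset.sum_congr rfl fun i _ => Finset.sum_congr rfl fun j _ => by ring
    rw [hadd, ← hs]
    ring
  have h3 : ∑ i, ∑ j, (p i + p j) / 2 * ‖a i j‖ ^ 2 =
      offDiagWeight p a + ∑ i, p i * ‖a i i‖ ^ 2 := by
    rw [offDiagWeight, ← Finset.sum_add_distrib]
    refine Finset.sum_congr rfl fun i _ => ?_
    have hi : p i * ‖a i i‖ ^ 2 = ∑ j, if i = j then p j * ‖a j j‖ ^ 2 else 0 := by simp
    rw [hi, ← Finset.sum_add_distrib]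
    refine Finset.sum_congr rfl fun j _ => ?_
    split_ifs with h
    · subst h; ring
    · ring
  have h4 : ((diagonal (fun i => (p i : ℂ)) * a).trace).re = ∑ i, p i * (a i i).re := by
    simp [Matrix.trace, diagonal_mul]
  have h5 : (∑ i, p i * (a i i).re) ^ 2 ≤ (∑ i, p i) * ∑ i, p i * ‖a i i‖ ^ 2 := by
    refine (Finset.sum_sq_le_sum_mul_sum_of_sq_le_mul (f := p)
      (g := fun i => p i * (a i i).re ^ 2) _ (fun i _ => hp i)
      (fun i _ => mul_nonneg (hp i) (sq_nonneg _)) fun i _ => le_of_eq (by ring)).trans ?_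
    rw [hp1, one_mul, one_mul]
    refine Finset.sum_le_sum fun i _ => mul_le_mul_of_nonneg_left ?_ (hp i)
    exact sq_le_sq.2 (by simpa using Complex.abs_re_le_norm (a i i))
  rw [matVariance, h1, h2, h3, h4]
  rw [hp1, one_mul] at h5
  linarith

end Diagonal

/-- Combines the two products of a skew information and a weight into the bound by `Usld`. -/
theorem le_sqrt_mul_sqrt {t I₁ I₂ W₁ W₂ V₁ V₂ : ℝ} (ht : 0 ≤ t) (hI₁ : 0 ≤ I₁) (hI₂ : 0 ≤ I₂)
    (hIW₁ : I₁ ≤ W₁) (hIW₂ : I₂ ≤ W₂) (hWV₁ : W₁ ≤ V₁) (hWV₂ : W₂ ≤ V₂)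
    (h₁₂ : t ≤ I₁ * W₂) (h₂₁ : t ≤ I₂ * W₁) :
    t ≤ √(V₁ ^ 2 - (V₁ - I₁) ^ 2) * √(V₂ ^ 2 - (V₂ - I₂) ^ 2) := by
  have h₁ : I₁ * W₁ ≤ V₁ ^ 2 - (V₁ - I₁) ^ 2 := by nlinarith
  have h₂ : I₂ * W₂ ≤ V₂ ^ 2 - (V₂ - I₂) ^ 2 := by nlinarith
  have h₀ : 0 ≤ I₁ * W₁ := mul_nonneg hI₁ (hI₁.trans hIW₁)
  rw [← Real.sqrt_mul (h₀.trans h₁)]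
  refine Real.le_sqrt_of_sq_le ?_
  calc t ^ 2 = t * t := sq t
    _ ≤ (I₁ * W₂) * (I₂ * W₁) := mul_le_mul h₁₂ h₂₁ ht (ht.trans h₁₂)
    _ = (I₁ * W₁) * (I₂ * W₂) := by ring
    _ ≤ _ := mul_le_mul h₁ h₂ (mul_nonneg hI₂ (hI₂.trans hIW₂)) (h₀.trans h₁)

/-- Gibilisco–Isola Type-1 uncertainty relation at `f_SLD`:
`U^SLD_ρ(A) · U^SLD_ρ(B) ≥ (1/4)|Tr[ρ[A,B]]|²`. -/
theorem gibilisco_isola_uncertainty {n : ℕ}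
    (ρ A B : Matrix (Fin n) (Fin n) ℂ)
    (hρ : ρ.PosSemidef) (htr : ρ.trace = 1)
    (hA : A.IsHermitian) (hB : B.IsHermitian)
    (p : Fin n → ℝ) (v : Fin n → Fin n → ℂ)
    (hp : ∀ i, 0 ≤ p i)
    (horth : ∀ i j, star (v i) ⬝ᵥ v j = if i = j then 1 else 0)
    (hdec : ρ = ∑ i, (p i : ℂ) • vecMulVec (v i) (star (v i))) :
    (1 / 4) * ‖(ρ * (A * B - B * A)).trace‖ ^ 2 ≤ Usld ρ p v A * Usld ρ p v B := by
  set U : Matrix (Fin n) (Fin n) ℂ := Matrix.of fun k i => v i k with hU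
  have hUU : Uᴴ * U = 1 := by
    ext i j
    rw [Matrix.one_apply, ← horth i j]
    simp [hU, Matrix.mul_apply, dotProduct]
  have hUU' : U * Uᴴ = 1 := mul_eq_one_comm.1 hUU
  have hρU : ρ = U * diagonal (fun i => (p i : ℂ)) * Uᴴ := by
    rw [hdec]
    ext k l
    rw [Matrix.mul_apply]
    simp only [Matrix.sum_apply, Matrix.smul_apply, vecMulVec_apply, mul_diagonal, hU, of_apply,
      conjTranspose_apply, Pi.star_apply, smul_eq_mul]
    exact Finset.sum_congr rfl fun i _ => by ring
  have htrace (X : Matrix (Fin n) (Fin n) ℂ) :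
      (ρ * X).trace = (diagonal (fun i => (p i : ℂ)) * (Uᴴ * X * U)).trace := by
    rw [hρU, mul_assoc, mul_assoc, trace_mul_comm]
    simp only [mul_assoc]
  have hmul (X Y : Matrix (Fin n) (Fin n) ℂ) :
      Uᴴ * (X * Y) * U = (Uᴴ * X * U) * (Uᴴ * Y * U) := by
    calc Uᴴ * (X * Y) * U = Uᴴ * X * 1 * Y * U := by simp only [mul_assoc, one_mul]
      _ = _ := by rw [← hUU']; simp only [mul_assoc]
  have hp1 : ∑ i, p i = 1 := by
    have h := htrace 1
    rw [mul_one, htr, mul_one, hUU, mul_one, trace_diagonal] at h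
    exact_mod_cast h.symm
  have hvar (X : Matrix (Fin n) (Fin n) ℂ) :
      matVariance ρ X = matVariance (diagonal fun i => (p i : ℂ)) (Uᴴ * X * U) := by
    rw [matVariance, matVariance, htrace, htrace, hmul]
  have hskew (X : Matrix (Fin n) (Fin n) ℂ) : sldSkew p v X = diagSkew p (Uᴴ * X * U) := by
    have (i j : Fin n) : star (v i) ⬝ᵥ X.mulVec (v j) = (Uᴴ * X * U) i j := by
      rw [mul_assoc, Matrix.mul_apply]
      simp [hU, dotProduct, mulVec, Matrix.mul_apply]
    simp only [sldSkew, diagSkew, this]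
  have hcomm : (ρ * (A * B - B * A)).trace = (diagonal (fun i => (p i : ℂ)) *
      ((Uᴴ * A * U) * (Uᴴ * B * U) - (Uᴴ * B * U) * (Uᴴ * A * U))).trace := by
    rw [htrace, mul_sub, sub_mul, hmul, hmul]
  have ha : (Uᴴ * A * U).IsHermitian := isHermitian_conjTranspose_mul_mul U hA
  have hb : (Uᴴ * B * U).IsHermitian := isHermitian_conjTranspose_mul_mul U hB
  have hab := norm_trace_commutator_sq_le (a := Uᴴ * A * U) hp hb
  have hba := norm_trace_commutator_sq_le (a := Uᴴ * B * U) hp ha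
  rw [← neg_sub, mul_neg, trace_neg, norm_neg] at hba
  rw [Usld, Usld, hcomm, hvar, hvar, hskew, hskew]
  have hIA := diagSkew_nonneg (a := Uᴴ * A * U) hp
  have hIB := diagSkew_nonneg (a := Uᴴ * B * U) hp
  have hIWA := diagSkew_le_offDiagWeight (a := Uᴴ * A * U) hp
  have hIWB := diagSkew_le_offDiagWeight (a := Uᴴ * B * U) hp
  have hWVA := offDiagWeight_le_variance hp hp1 ha
  have hWVB := offDiagWeight_le_variance hp hp1 hb
  exact le_sqrt_mul_sqrt (by positivity) hIA hIB hIWA hIWB hWVA hWVB hab hba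
end

section
/- In the indirect-measurement setup under a conservation law, the noise operator satisfies the exact commutator identity N(A_S⊗1_E + 1_S⊗A_E) − (A_S⊗1_E + 1_S⊗A_E)N = (B_S A_S − A_S B_S) ⊗ 1_E. In particular, for all density matrices ρ_S, ρ_E, Tr[(ρ_S⊗ρ_E)[N, A_S⊗1_E + 1_S⊗A_E]] = Tr[ρ_S[B_S, A_S]]. -/
open Matrix Kronecker
open scoped ComplexOrder

/-- The noise operator `N := B_S ⊗ 1_E − U† (1_S ⊗ M_E) U`. -/
noncomputable def noiseOp {dS dE : ℕ} (BS : Matrix (Fin dS) (Fin dS) ℂ)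
    (ME : Matrix (Fin dE) (Fin dE) ℂ)
    (U : Matrix (Fin dS × Fin dE) (Fin dS × Fin dE) ℂ) :
    Matrix (Fin dS × Fin dE) (Fin dS × Fin dE) ℂ :=
  BS ⊗ₖ (1 : Matrix (Fin dE) (Fin dE) ℂ) - Uᴴ * ((1 : Matrix (Fin dS) (Fin dS) ℂ) ⊗ₖ ME) * U

/-- The inverse of a unitary commutes with everything that the unitary commutes with. -/
lemma commute_conjTranspose_of_unitary {n : Type*} [Fintype n] [DecidableEq n]
    {U L : Matrix n n ℂ} (hU : Uᴴ * U = 1) (hU' : U * Uᴴ = 1) (h : Commute U L) :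
    Commute Uᴴ L := by
  calc Uᴴ * L = Uᴴ * (L * U) * Uᴴ := by simp only [Matrix.mul_assoc, hU', Matrix.mul_one]
    _ = L * Uᴴ := by rw [← h.eq, ← Matrix.mul_assoc, hU, Matrix.one_mul]

/-- The key commutator identity in the derivation of the improved WAY–Ozawa theorem:
`[N, A_S⊗1 + 1⊗A_E] = [B_S, A_S] ⊗ 1`, and hence for all density matrices `ρ_S, ρ_E`,
`Tr[(ρ_S⊗ρ_E)[N, A_S⊗1 + 1⊗A_E]] = Tr[ρ_S [B_S,A_S]]`. -/
theorem noise_commutator_identity {dS dE : ℕ}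
    (AS BS : Matrix (Fin dS) (Fin dS) ℂ) (hAS : AS.IsHermitian) (hBS : BS.IsHermitian)
    (AE ME : Matrix (Fin dE) (Fin dE) ℂ) (hAE : AE.IsHermitian) (hME : ME.IsHermitian)
    (hMEAE : ME * AE = AE * ME)
    (U : Matrix (Fin dS × Fin dE) (Fin dS × Fin dE) ℂ)
    (hU : Uᴴ * U = 1) (hU' : U * Uᴴ = 1)
    (hcons : U * (AS ⊗ₖ (1 : Matrix (Fin dE) (Fin dE) ℂ) +
        (1 : Matrix (Fin dS) (Fin dS) ℂ) ⊗ₖ AE) =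
      (AS ⊗ₖ (1 : Matrix (Fin dE) (Fin dE) ℂ) +
        (1 : Matrix (Fin dS) (Fin dS) ℂ) ⊗ₖ AE) * U) :
    noiseOp BS ME U * (AS ⊗ₖ (1 : Matrix (Fin dE) (Fin dE) ℂ) +
        (1 : Matrix (Fin dS) (Fin dS) ℂ) ⊗ₖ AE) -
      (AS ⊗ₖ (1 : Matrix (Fin dE) (Fin dE) ℂ) +
        (1 : Matrix (Fin dS) (Fin dS) ℂ) ⊗ₖ AE) * noiseOp BS ME U =
      (BS * AS - AS * BS) ⊗ₖ (1 : Matrix (Fin dE) (Fin dE) ℂ) ∧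
    ∀ (ρS : Matrix (Fin dS) (Fin dS) ℂ) (ρE : Matrix (Fin dE) (Fin dE) ℂ),
      ρS.PosSemidef → ρS.trace = 1 → ρE.PosSemidef → ρE.trace = 1 →
      ((ρS ⊗ₖ ρE) * (noiseOp BS ME U * (AS ⊗ₖ (1 : Matrix (Fin dE) (Fin dE) ℂ) +
          (1 : Matrix (Fin dS) (Fin dS) ℂ) ⊗ₖ AE) -
        (AS ⊗ₖ (1 : Matrix (Fin dE) (Fin dE) ℂ) +
          (1 : Matrix (Fin dS) (Fin dS) ℂ) ⊗ₖ AE) * noiseOp BS ME U)).trace =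
        (ρS * (BS * AS - AS * BS)).trace := by
  have key : noiseOp BS ME U * (AS ⊗ₖ (1 : Matrix (Fin dE) (Fin dE) ℂ) +
        (1 : Matrix (Fin dS) (Fin dS) ℂ) ⊗ₖ AE) -
      (AS ⊗ₖ (1 : Matrix (Fin dE) (Fin dE) ℂ) +
        (1 : Matrix (Fin dS) (Fin dS) ℂ) ⊗ₖ AE) * noiseOp BS ME U =
      (BS * AS - AS * BS) ⊗ₖ (1 : Matrix (Fin dE) (Fin dE) ℂ) := by
    have hM : Commute ((1 : Matrix (Fin dS) (Fin dS) ℂ) ⊗ₖ ME)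
        (AS ⊗ₖ (1 : Matrix (Fin dE) (Fin dE) ℂ) +
          (1 : Matrix (Fin dS) (Fin dS) ℂ) ⊗ₖ AE) := by
      simp only [Commute, SemiconjBy, mul_add, add_mul, ← mul_kronecker_mul, one_mul, mul_one,
        hMEAE]
    have hUMU := ((commute_conjTranspose_of_unitary hU hU' hcons).mul_left hM).mul_left hcons
    rw [noiseOp, sub_mul, mul_sub, hUMU.eq, sub_sub_sub_cancel_right]
    simp only [mul_add, add_mul, ← mul_kronecker_mul, one_mul, mul_one, add_sub_add_right_eq_sub]
    ext ⟨i, k⟩ ⟨j, l⟩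
    simp only [Matrix.sub_apply, kronecker_apply, sub_mul]
  refine ⟨key, fun ρS ρE _ _ _ hρE => ?_⟩
  rw [key, ← mul_kronecker_mul, mul_one, trace_kronecker, hρE, mul_one]
end

section
/- In the indirect-measurement setup under a conservation law, assume additionally that A_S is positive semidefinite, and let ε > 0 be such that Tr[(ρ_S⊗ρ_E)N²] ≤ ε² for every density matrix ρ_S on S. Then ε² · (‖A_S‖²/4 + I_SLD(ρ_E, A_E)) ≥ ‖A_S B_S − B_S A_S‖²/4, where ‖·‖ denotes the ℓ²→ℓ² operator norm of a matrix. -/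
open Matrix Kronecker
open scoped ComplexOrder

/-- The ℓ²→ℓ² operator norm of a square complex matrix. -/
noncomputable def opNorm {m : Type*} [Fintype m] [DecidableEq m]
    (A : Matrix m m ℂ) : ℝ :=
  ‖Matrix.toEuclideanCLM (𝕜 := ℂ) (n := m) A‖

lemma Matrix.sub_kronecker {l m n p : Type*} (A B : Matrix l m ℂ) (C : Matrix n p ℂ) :
    (A - B) ⊗ₖ C = A ⊗ₖ C - B ⊗ₖ C := by
  ext
  simp [sub_mul]

lemma Matrix.kronecker_sub {l m n p : Type*} (A : Matrix l m ℂ) (B C : Matrix n p ℂ) :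
    A ⊗ₖ (B - C) = A ⊗ₖ B - A ⊗ₖ C := by
  ext
  simp [mul_sub]

lemma trace_vecMulVec_star_mul {n : Type*} [Fintype n] (ψ : n → ℂ) (M : Matrix n n ℂ) :
    (vecMulVec ψ (star ψ) * M).trace = star ψ ⬝ᵥ M *ᵥ ψ := by
  rw [vecMulVec_mul, trace_vecMulVec, dotProduct_comm, dotProduct_mulVec]

lemma opNorm_nonneg {n : Type*} [Fintype n] [DecidableEq n] (A : Matrix n n ℂ) : 0 ≤ opNorm A :=
  norm_nonneg _

lemma opNorm_smul {n : Type*} [Fintype n] [DecidableEq n] (c : ℂ) (A : Matrix n n ℂ) :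
    opNorm (c • A) = ‖c‖ * opNorm A := by
  simp [opNorm, norm_smul]

lemma inner_toEuclideanCLM_self {n : Type*} [Fintype n] [DecidableEq n]
    (A : Matrix n n ℂ) (x : EuclideanSpace ℂ n) :
    inner ℂ x (toEuclideanCLM (𝕜 := ℂ) A x) = star x.ofLp ⬝ᵥ A *ᵥ x.ofLp := by
  rw [EuclideanSpace.inner_eq_star_dotProduct, ofLp_toEuclideanCLM, dotProduct_comm]

/-- The operator norm of a Hermitian matrix is at most any bound on its expectation values. -/
lemma opNorm_le_of_abs_expectation_le {n : Type*} [Fintype n] [DecidableEq n]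
    {H : Matrix n n ℂ} (hH : H.IsHermitian) {c : ℝ} (hc : 0 ≤ c)
    (h : ∀ ψ : n → ℂ, star ψ ⬝ᵥ ψ = 1 → |(star ψ ⬝ᵥ H *ᵥ ψ).re| ≤ c) : opNorm H ≤ c := by
  have hsymm : (toEuclideanCLM (𝕜 := ℂ) H : EuclideanSpace ℂ n →ₗ[ℂ] _).IsSymmetric :=
    isSymmetric_toEuclideanLin_iff.mpr hH
  rw [opNorm, ContinuousLinearMap.norm_eq_iSup_rayleighQuotient _ hsymm]
  refine ciSup_le fun x => ?_
  by_cases hx : x = 0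
  · simpa [hx] using hc
  have hx' : ‖x‖ ≠ 0 := by simpa using hx
  rw [← ContinuousLinearMap.rayleigh_smul _ x (c := ((‖x‖⁻¹ : ℝ) : ℂ)) (by simpa using hx)]
  set y := ((‖x‖⁻¹ : ℝ) : ℂ) • x
  have hy : ‖y‖ = 1 := by simp [y, norm_smul, hx']
  have hyy : star y.ofLp ⬝ᵥ y.ofLp = 1 := by
    rw [dotProduct_comm, ← EuclideanSpace.inner_eq_star_dotProduct, inner_self_eq_norm_sq_to_K, hy]
    simp
  have := h y.ofLp hyy
  rw [← inner_toEuclideanCLM_self] at this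
  rwa [ContinuousLinearMap.rayleighQuotient, hy, one_pow, div_one,
    ContinuousLinearMap.reApplyInnerSelf_apply, ← inner_conj_symm, RCLike.conj_re]

open scoped MatrixOrder Matrix.Norms.L2Operator in
lemma Matrix.PosSemidef.expectation_sq_le {n : Type*} [Fintype n] [DecidableEq n]
    {A : Matrix n n ℂ} (hA : A.PosSemidef) (ψ : n → ℂ) :
    (star ψ ⬝ᵥ (A * A) *ᵥ ψ).re ≤ opNorm A * (star ψ ⬝ᵥ A *ᵥ ψ).re := by
  have hle : A ≤ algebraMap ℝ _ (opNorm A) :=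
    IsSelfAdjoint.le_algebraMap_norm_self (a := A) hA.1
  set S := CFC.sqrt A
  have hS : S.IsHermitian := (CFC.sqrt_nonneg A).isSelfAdjoint
  have hSS : S * S = A := CFC.sqrt_mul_sqrt_self A hA.nonneg
  have hpos := (Matrix.le_iff.mp hle).conjTranspose_mul_mul_same S
  have hexp : Sᴴ * (algebraMap ℝ _ (opNorm A) - A) * S = opNorm A • A - A * A := by
    rw [hS.eq, mul_sub, sub_mul, ← Algebra.commutes, mul_assoc, hSS, ← Algebra.smul_def]
    congr 1
    rw [← hSS]
    simp only [mul_assoc]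
  rw [hexp] at hpos
  have := (Complex.le_def.mp (hpos.dotProduct_mulVec_nonneg ψ)).1
  rw [sub_mulVec, dotProduct_sub, smul_mulVec, dotProduct_smul] at this
  simpa using this

lemma Matrix.PosSemidef.variance_le {n : Type*} [Fintype n] [DecidableEq n]
    {A : Matrix n n ℂ} (hA : A.PosSemidef) (ψ : n → ℂ) :
    (star ψ ⬝ᵥ (A * A) *ᵥ ψ).re - (star ψ ⬝ᵥ A *ᵥ ψ).re ^ 2 ≤ opNorm A ^ 2 / 4 := by
  nlinarith [hA.expectation_sq_le ψ, sq_nonneg (opNorm A / 2 - (star ψ ⬝ᵥ A *ᵥ ψ).re)]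

/-- The symmetric logarithmic derivative of a state with spectral decomposition `(p, v)` along the
unitary orbit generated by `A`. -/
lemma exists_symmetricLogDeriv {n : ℕ} {ρ A : Matrix (Fin n) (Fin n) ℂ} (hA : A.IsHermitian)
    {p : Fin n → ℝ} {v : Fin n → Fin n → ℂ} (hp : ∀ i, 0 ≤ p i)
    (hv : ∀ i j, star (v i) ⬝ᵥ v j = if i = j then 1 else 0)
    (hρ : ρ = ∑ i, (p i : ℂ) • vecMulVec (v i) (star (v i))) :
    ∃ K : Matrix (Fin n) (Fin n) ℂ, K.IsHermitian ∧
      K * ρ + ρ * K = -Complex.I • (A * ρ - ρ * A) ∧ (ρ * (K * K)).trace = sldSkew p v A := by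
  set V : Matrix (Fin n) (Fin n) ℂ := of fun a i => v i a
  have hVV : Vᴴ * V = 1 := by
    ext i j
    simpa [Matrix.mul_apply, dotProduct, V, Matrix.one_apply] using hv i j
  have hVV' : V * Vᴴ = 1 := mul_eq_one_comm.mp hVV
  set D : Matrix (Fin n) (Fin n) ℂ := diagonal fun i => (p i : ℂ)
  have hρD : ρ = V * D * Vᴴ := by
    ext a b
    rw [hρ, Matrix.mul_apply, Matrix.sum_apply]
    simp only [D, V, Matrix.mul_diagonal, of_apply, Matrix.smul_apply, vecMulVec_apply,
      Pi.star_apply, conjTranspose_apply, smul_eq_mul]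
    exact Finset.sum_congr rfl fun i _ => by ring
  set G := Vᴴ * A * V
  have hAG : A = V * G * Vᴴ := by
    simp only [G, ← mul_assoc, hVV', one_mul]
    rw [mul_assoc, hVV', mul_one]
  have hG : G.IsHermitian := isHermitian_conjTranspose_mul_mul V hA
  have hGv (i j) : G i j = star (v i) ⬝ᵥ A *ᵥ v j := by
    simp only [G, mul_assoc, Matrix.mul_apply, dotProduct, V, conjTranspose_apply, of_apply,
      mulVec, Pi.star_apply]
  set k : Matrix (Fin n) (Fin n) ℂ :=
    of fun i j => Complex.I * (((p i - p j) / (p i + p j) : ℝ) : ℂ) * G i j with hk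
  have hkH : k.IsHermitian := by
    ext i j
    rw [conjTranspose_apply, hk, of_apply, of_apply, star_mul', star_mul', hG.apply, add_comm]
    simp only [RCLike.star_def, Complex.conj_I, Complex.conj_ofReal]
    push_cast
    ring
  have hkD : k * D + D * k = -Complex.I • (G * D - D * G) := by
    ext i j
    simp only [D, Matrix.add_apply, Matrix.smul_apply, Matrix.sub_apply, mul_diagonal,
      diagonal_mul, hk, of_apply, smul_eq_mul]
    have : (((p i - p j) / (p i + p j) : ℝ) : ℂ) * ((p i + p j : ℝ) : ℂ) = ((p i - p j : ℝ) : ℂ) := by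
      norm_cast
      by_cases h : p i + p j = 0
      · have hi : p i = 0 := by linarith [hp i, hp j]
        have hj : p j = 0 := by linarith [hp i, hp j]
        simp [hi, hj]
      · exact div_mul_cancel₀ _ h
    push_cast at this ⊢
    linear_combination Complex.I * G i j * this
  have hconj (X Y : Matrix (Fin n) (Fin n) ℂ) : V * X * Vᴴ * (V * Y * Vᴴ) = V * (X * Y) * Vᴴ := by
    calc V * X * Vᴴ * (V * Y * Vᴴ) = V * X * (Vᴴ * V) * Y * Vᴴ := by simp only [mul_assoc]
      _ = V * (X * Y) * Vᴴ := by rw [hVV, mul_one, mul_assoc V]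
  refine ⟨V * k * Vᴴ, isHermitian_mul_mul_conjTranspose V hkH, ?_, ?_⟩
  · rw [hρD]
    conv_rhs => rw [hAG]
    simp only [hconj, ← mul_add, ← add_mul, ← mul_sub, ← sub_mul, hkD, Matrix.mul_smul, Matrix.smul_mul]
  · rw [hρD, hconj, hconj, trace_mul_cycle, hVV, one_mul]
    have hterm (i j) : (D * k) i j * k j i = ((p i *
        ((p i - p j) ^ 2 / (p i + p j) ^ 2 * ‖G i j‖ ^ 2) : ℝ) : ℂ) := by
      have hGG : G i j * G j i = ((‖G i j‖ ^ 2 : ℝ) : ℂ) := by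
        rw [← hG.apply j i, RCLike.star_def, Complex.mul_conj, Complex.normSq_eq_norm_sq]
      simp only [D, diagonal_mul, hk, of_apply]
      rw [add_comm (p j)]
      rw [← div_pow, Complex.ofReal_mul, Complex.ofReal_mul, ← hGG, ← neg_sub (p i) (p j), neg_div]
      push_cast
      linear_combination (-(p i : ℂ) * ((p i - p j) / (p i + p j)) ^ 2 * G i j * G j i) *
        Complex.I_sq
    have hGsymm (i j) : ‖G i j‖ = ‖G j i‖ := by rw [← hG.apply, norm_star]
    rw [← mul_assoc, trace]
    simp only [diag_apply, Matrix.mul_apply (M := D * k), hterm]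
    norm_cast
    have hswap : ∑ i, ∑ j, p i * ((p i - p j) ^ 2 / (p i + p j) ^ 2 * ‖G i j‖ ^ 2) =
        ∑ i, ∑ j, p j * ((p i - p j) ^ 2 / (p i + p j) ^ 2 * ‖G i j‖ ^ 2) := by
      rw [Finset.sum_comm]
      refine Finset.sum_congr rfl fun i _ => Finset.sum_congr rfl fun j _ => ?_
      rw [hGsymm, add_comm (p j), sub_sq_comm]
    have hsum : ∑ i, ∑ j, (p i - p j) ^ 2 / (p i + p j) * ‖G i j‖ ^ 2 =
        ∑ i, ∑ j, p i * ((p i - p j) ^ 2 / (p i + p j) ^ 2 * ‖G i j‖ ^ 2) +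
        ∑ i, ∑ j, p j * ((p i - p j) ^ 2 / (p i + p j) ^ 2 * ‖G i j‖ ^ 2) := by
      simp only [← Finset.sum_add_distrib]
      refine Finset.sum_congr rfl fun i _ => Finset.sum_congr rfl fun j _ => ?_
      by_cases h : p i + p j = 0
      · rw [← add_mul]
        simp [h]
      · field_simp
    simp only [sldSkew, ← hGv, hsum, ← hswap]
    ring

/-- For a rank-one projection `P`, the commutator with `A` realizes the variance of `A`. -/
lemma trace_mul_commutator_sq {n : Type*} [Fintype n] {P A : Matrix n n ℂ} (hP : P * P = P)
    {a : ℂ} (ha : P * A * P = a • P) :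
    (P * ((-Complex.I • (A * P - P * A)) * (-Complex.I • (A * P - P * A)))).trace =
      (P * (A * A)).trace - a ^ 2 * P.trace := by
  have hmul : P * ((A * P - P * A) * (A * P - P * A)) = (a ^ 2) • P - P * (A * A) * P := by
    have h1 : P * A * P * A * P = (a ^ 2) • P := by
      rw [ha, smul_mul, smul_mul, ha, smul_smul, sq]
    have hPX (X : Matrix n n ℂ) : P * (P * X) = P * X := by rw [← mul_assoc, hP]
    rw [← h1]
    simp only [mul_sub, sub_mul, mul_assoc, hPX]
    abel
  rw [smul_mul, Matrix.mul_smul, Matrix.mul_smul, Matrix.mul_smul, smul_smul, hmul, trace_smul, trace_sub,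
    trace_smul, trace_mul_comm (P * (A * A)), ← mul_assoc, hP, smul_eq_mul, smul_eq_mul,
    neg_mul_neg, Complex.I_mul_I]
  ring

/-- The Cauchy–Schwarz inequality for Hermitian observables in the state `σ`. -/
lemma Matrix.PosSemidef.sq_trace_anticommutator_le {n : Type*} [Fintype n]
    {σ N K : Matrix n n ℂ} (hσ : σ.PosSemidef) (hN : N.IsHermitian) (hK : K.IsHermitian) :
    (σ * (N * K + K * N)).trace.re ^ 2 ≤
      4 * (σ * (N * N)).trace.re * (σ * (K * K)).trace.re := by
  have hquad (t : ℝ) : 0 ≤ (σ * (K * K)).trace.re * (t * t) +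
      (σ * (N * K + K * N)).trace.re * t + (σ * (N * N)).trace.re := by
    have hX : (N + t • K).IsHermitian := hN.add (hK.smul (IsSelfAdjoint.all t))
    have hpos := (hσ.mul_mul_conjTranspose_same (N + t • K)).trace_nonneg
    rw [trace_mul_cycle, trace_mul_comm, hX.eq] at hpos
    have hre := (Complex.le_def.mp hpos).1
    simp only [mul_add, add_mul, Matrix.mul_smul, smul_mul, trace_add, trace_smul, Complex.add_re,
      Complex.zero_re, Complex.smul_re, smul_eq_mul] at hre ⊢
    linarith
  have := discrim_le_zero hquad
  rw [discrim] at this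
  linarith

/-- The uncertainty relation for a Hermitian `K` that solves the logarithmic derivative equation
of `σ` along `A`. -/
lemma Matrix.PosSemidef.sq_trace_commutator_le {n : Type*} [Fintype n]
    {σ N A K : Matrix n n ℂ} (hσ : σ.PosSemidef) (hN : N.IsHermitian) (hK : K.IsHermitian)
    (hKA : K * σ + σ * K = -Complex.I • (A * σ - σ * A)) :
    (σ * (-Complex.I • (N * A - A * N))).trace.re ^ 2 ≤
      4 * (σ * (N * N)).trace.re * (σ * (K * K)).trace.re := by
  have htr : (σ * (-Complex.I • (N * A - A * N))).trace = (σ * (N * K + K * N)).trace := by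
    calc (σ * (-Complex.I • (N * A - A * N))).trace
        = (N * (-Complex.I • (A * σ - σ * A))).trace := by
          simp only [Matrix.mul_smul, trace_smul, mul_sub, trace_sub, ← mul_assoc]
          rw [trace_mul_cycle σ N A, trace_mul_cycle A σ N, trace_mul_cycle σ A N]
      _ = (σ * (N * K + K * N)).trace := by
          rw [← hKA]
          simp only [mul_add, trace_add, ← mul_assoc]
          rw [trace_mul_cycle σ N K, trace_mul_cycle K σ N, trace_mul_cycle σ K N, add_comm]
  rw [htr]
  exact hσ.sq_trace_anticommutator_le hN hK

/-- The commutator of the noise operator with the conserved quantity is `[B_S, A_S] ⊗ 1`, since the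
conserved quantity commutes with the evolved meter observable. -/
lemma noiseOp_commutator {dS dE : ℕ} {AS BS : Matrix (Fin dS) (Fin dS) ℂ}
    {AE ME : Matrix (Fin dE) (Fin dE) ℂ} (hMEAE : ME * AE = AE * ME)
    {U : Matrix (Fin dS × Fin dE) (Fin dS × Fin dE) ℂ} (hU : Uᴴ * U = 1) (hU' : U * Uᴴ = 1)
    (hcons : U * (AS ⊗ₖ (1 : Matrix (Fin dE) (Fin dE) ℂ) +
        (1 : Matrix (Fin dS) (Fin dS) ℂ) ⊗ₖ AE) =
      (AS ⊗ₖ (1 : Matrix (Fin dE) (Fin dE) ℂ) + (1 : Matrix (Fin dS) (Fin dS) ℂ) ⊗ₖ AE) * U) :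
    noiseOp BS ME U * (AS ⊗ₖ 1 + 1 ⊗ₖ AE) - (AS ⊗ₖ 1 + 1 ⊗ₖ AE) * noiseOp BS ME U =
      (BS * AS - AS * BS) ⊗ₖ 1 := by
  set Q := AS ⊗ₖ (1 : Matrix (Fin dE) (Fin dE) ℂ) + (1 : Matrix (Fin dS) (Fin dS) ℂ) ⊗ₖ AE
    with hQ
  have hcons' : Uᴴ * Q = Q * Uᴴ := by
    calc Uᴴ * Q = Uᴴ * (Q * U) * Uᴴ := by rw [mul_assoc, mul_assoc Q, hU', mul_one]
      _ = Q * Uᴴ := by rw [← hcons, ← mul_assoc, hU, one_mul]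
  have hM : ((1 : Matrix (Fin dS) (Fin dS) ℂ) ⊗ₖ ME) * Q = Q * (1 ⊗ₖ ME) := by
    simp only [hQ, mul_add, add_mul, ← mul_kronecker_mul, one_mul, mul_one, hMEAE]
  have hUM : Uᴴ * ((1 : Matrix (Fin dS) (Fin dS) ℂ) ⊗ₖ ME) * U * Q =
      Q * (Uᴴ * ((1 : Matrix (Fin dS) (Fin dS) ℂ) ⊗ₖ ME) * U) := by
    rw [mul_assoc _ U, hcons, ← mul_assoc, mul_assoc Uᴴ, hM, ← mul_assoc Uᴴ, hcons']
    simp only [mul_assoc]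
  rw [noiseOp, sub_mul, mul_sub, hUM, sub_sub_sub_cancel_right]
  simp only [hQ, mul_add, add_mul, ← mul_kronecker_mul, one_mul, mul_one, sub_kronecker]
  abel

lemma noiseOp_isHermitian {dS dE : ℕ} {BS : Matrix (Fin dS) (Fin dS) ℂ}
    {ME : Matrix (Fin dE) (Fin dE) ℂ} (hBS : BS.IsHermitian) (hME : ME.IsHermitian)
    (U : Matrix (Fin dS × Fin dE) (Fin dS × Fin dE) ℂ) : (noiseOp BS ME U).IsHermitian := by
  refine IsHermitian.sub ?_ (isHermitian_conjTranspose_mul_mul U ?_) <;>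
    simp [IsHermitian, conjTranspose_kronecker, hBS.eq, hME.eq]

lemma isHermitian_neg_I_smul_commutator {n : Type*} [Fintype n] {A B : Matrix n n ℂ}
    (hA : A.IsHermitian) (hB : B.IsHermitian) : (-Complex.I • (A * B - B * A)).IsHermitian := by
  rw [IsHermitian, conjTranspose_smul, conjTranspose_sub, conjTranspose_mul, conjTranspose_mul,
    hA.eq, hB.eq, ← neg_sub (A * B), smul_neg, ← neg_smul]
  simp

/-- Coherence-cost lower bound for measurement (SLD form): if the worst-case error is
at most `ε`, then `ε² (‖A_S‖²/4 + I_SLD(ρ_E,A_E)) ≥ ‖[A_S,B_S]‖²/4`. -/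
theorem coherence_cost_lower_bound_SLD {dS dE : ℕ}
    (ρE : Matrix (Fin dE) (Fin dE) ℂ) (hρE : ρE.PosSemidef) (htrE : ρE.trace = 1)
    (AS BS : Matrix (Fin dS) (Fin dS) ℂ) (hAS : AS.PosSemidef) (hBS : BS.IsHermitian)
    (AE ME : Matrix (Fin dE) (Fin dE) ℂ) (hAE : AE.IsHermitian) (hME : ME.IsHermitian)
    (hMEAE : ME * AE = AE * ME)
    (U : Matrix (Fin dS × Fin dE) (Fin dS × Fin dE) ℂ)
    (hU : Uᴴ * U = 1) (hU' : U * Uᴴ = 1)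
    (hcons : U * (AS ⊗ₖ (1 : Matrix (Fin dE) (Fin dE) ℂ) +
        (1 : Matrix (Fin dS) (Fin dS) ℂ) ⊗ₖ AE) =
      (AS ⊗ₖ (1 : Matrix (Fin dE) (Fin dE) ℂ) +
        (1 : Matrix (Fin dS) (Fin dS) ℂ) ⊗ₖ AE) * U)
    (pE : Fin dE → ℝ) (vE : Fin dE → Fin dE → ℂ)
    (hpE : ∀ i, 0 ≤ pE i)
    (horthE : ∀ i j, star (vE i) ⬝ᵥ vE j = if i = j then 1 else 0)
    (hdecE : ρE = ∑ i, (pE i : ℂ) • vecMulVec (vE i) (star (vE i)))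
    (ε : ℝ) (hε : 0 < ε)
    (herr : ∀ ρS : Matrix (Fin dS) (Fin dS) ℂ, ρS.PosSemidef → ρS.trace = 1 →
      (((ρS ⊗ₖ ρE) * (noiseOp BS ME U * noiseOp BS ME U)).trace).re ≤ ε ^ 2) :
    opNorm (AS * BS - BS * AS) ^ 2 / 4 ≤
      ε ^ 2 * (opNorm AS ^ 2 / 4 + sldSkew pE vE AE) := by
  obtain ⟨KE, hKE, hKEρ, hKEtr⟩ := exists_symmetricLogDeriv hAE hpE horthE hdecE
  set bound := opNorm AS ^ 2 / 4 + sldSkew pE vE AE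
  have key (ψ : Fin dS → ℂ) (hψ : star ψ ⬝ᵥ ψ = 1) :
      (star ψ ⬝ᵥ (-Complex.I • (BS * AS - AS * BS)) *ᵥ ψ).re ^ 2 ≤ 4 * (ε ^ 2 * bound) := by
    set P := vecMulVec ψ (star ψ) with hPdef
    have hP : P.PosSemidef := posSemidef_vecMulVec_self_star ψ
    have hPtr : P.trace = 1 := by rw [hPdef, trace_vecMulVec, dotProduct_comm, hψ]
    have hPAP : P * AS * P = (star ψ ⬝ᵥ AS *ᵥ ψ) • P := by
      rw [hPdef, vecMulVec_mul, vecMulVec_mul_vecMulVec, dotProduct_mulVec, vecMulVec_smul]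
    have hPP : P * P = P := by
      rw [hPdef, vecMulVec_mul_vecMulVec, hψ, one_smul]
    set KS := -Complex.I • (AS * P - P * AS) with hKSdef
    have hKS : KS.IsHermitian := isHermitian_neg_I_smul_commutator hAS.1 hP.1
    have hKSP : KS * P + P * KS = -Complex.I • (AS * P - P * AS) := by
      rw [hKSdef, smul_mul, Matrix.mul_smul, ← smul_add, sub_mul, mul_sub, mul_assoc AS, hPP,
        ← mul_assoc P P, hPP, ← mul_assoc P AS P]
      congr 1
      abel
    have hPKS : (P * KS).trace = 0 := by
      rw [hKSdef, Matrix.mul_smul, trace_smul, mul_sub, trace_sub, ← mul_assoc, ← mul_assoc, hPP,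
        trace_mul_cycle, hPP, sub_self, smul_zero]
    set K := KS ⊗ₖ (1 : Matrix (Fin dE) (Fin dE) ℂ) + (1 : Matrix (Fin dS) (Fin dS) ℂ) ⊗ₖ KE
      with hKdef
    have hK : K.IsHermitian := by
      refine IsHermitian.add ?_ ?_ <;>
        simp [IsHermitian, conjTranspose_kronecker, hKS.eq, hKE.eq]
    have hKσ : K * (P ⊗ₖ ρE) + (P ⊗ₖ ρE) * K = -Complex.I •
        ((AS ⊗ₖ 1 + 1 ⊗ₖ AE) * (P ⊗ₖ ρE) - (P ⊗ₖ ρE) * (AS ⊗ₖ 1 + 1 ⊗ₖ AE)) := by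
      have h1 : K * (P ⊗ₖ ρE) + (P ⊗ₖ ρE) * K =
          (KS * P + P * KS) ⊗ₖ ρE + P ⊗ₖ (KE * ρE + ρE * KE) := by
        simp only [hKdef, add_mul, mul_add, ← mul_kronecker_mul, one_mul, mul_one, add_kronecker,
          kronecker_add]
        abel
      rw [h1, hKSP, hKEρ, smul_kronecker, kronecker_smul, ← smul_add]
      simp only [add_mul, mul_add, ← mul_kronecker_mul, one_mul, mul_one, sub_kronecker,
        kronecker_sub]
      congr 1
      abel
    have hσKK : ((P ⊗ₖ ρE) * (K * K)).trace =
        (star ψ ⬝ᵥ (AS * AS) *ᵥ ψ) - (star ψ ⬝ᵥ AS *ᵥ ψ) ^ 2 + sldSkew pE vE AE := by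
      have h1 := trace_mul_commutator_sq hPP hPAP
      rw [← hKSdef, hPtr, trace_vecMulVec_star_mul ψ (AS * AS), mul_one] at h1
      simp only [hKdef, add_mul, mul_add, ← mul_kronecker_mul, one_mul, mul_one, trace_add,
        trace_kronecker, hPKS, hPtr, htrE, hKEtr, h1]
      ring
    have hvar : ((P ⊗ₖ ρE) * (K * K)).trace.re ≤ bound := by
      have him : (star ψ ⬝ᵥ AS *ᵥ ψ).im = 0 :=
        (Complex.le_def.mp (hAS.dotProduct_mulVec_nonneg ψ)).2.symm
      have := hAS.variance_le ψ
      simp only [hσKK, sq (star ψ ⬝ᵥ AS *ᵥ ψ), Complex.add_re, Complex.sub_re, Complex.mul_re, him,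
        Complex.ofReal_re]
      simp only [bound]
      linarith
    have hσ : (P ⊗ₖ ρE).PosSemidef := hP.kronecker hρE
    have hKK : 0 ≤ ((P ⊗ₖ ρE) * (K * K)).trace.re := by
      have h0 := (hσ.mul_mul_conjTranspose_same K).trace_nonneg
      rw [trace_mul_cycle, trace_mul_comm, hK.eq] at h0
      exact (Complex.le_def.mp h0).1
    have hunc := hσ.sq_trace_commutator_le (noiseOp_isHermitian hBS hME U) hK hKσ
    rw [noiseOp_commutator hMEAE hU hU' hcons, ← smul_kronecker, ← mul_kronecker_mul,
      trace_kronecker, mul_one, htrE, mul_one, trace_vecMulVec_star_mul] at hunc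
    nlinarith [mul_le_mul (herr P hP hPtr) hvar hKK (sq_nonneg ε)]
  have hcomm : opNorm (AS * BS - BS * AS) = opNorm (-Complex.I • (BS * AS - AS * BS)) := by
    rw [opNorm_smul, norm_neg, Complex.norm_I, one_mul, ← neg_sub, ← neg_one_smul ℂ, opNorm_smul]
    simp
  have hnorm : opNorm (-Complex.I • (BS * AS - AS * BS)) ≤ √(4 * (ε ^ 2 * bound)) :=
    opNorm_le_of_abs_expectation_le (isHermitian_neg_I_smul_commutator hBS hAS.1)
      (Real.sqrt_nonneg _) fun ψ hψ => Real.abs_le_sqrt (key ψ hψ)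
  have hbound : 0 ≤ bound := by
    refine add_nonneg (by positivity) (mul_nonneg (by norm_num) ?_)
    exact Finset.sum_nonneg fun i _ => Finset.sum_nonneg fun j _ =>
      mul_nonneg (div_nonneg (sq_nonneg _) (add_nonneg (hpE i) (hpE j))) (sq_nonneg _)
  have := (Real.le_sqrt (opNorm_nonneg _) (by positivity)).mp hnorm
  rw [hcomm]
  linarith
end
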